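/- Let n and m be integers with 2 ≤ m ≤ n−2, let μ = (μ_1,…,μ_m) be an m-partition of n, and let F ∈ ℂ[x] have degree n and exactly m distinct complex roots. Then D_μ(F) ≠ 0 if and only if mult(F) = μ. -/

import Mathlib

open Polynomial Finset Equiv

/-- `dp [F_1, …, F_k]`: the determinant of the `k × k` matrix whose `(i,j)` entry
(0-indexed) is the coefficient of `x^{k−1−j}` in `F_i`, for polynomials of
degree at most `k − 1`. -/
noncomputable def dp {k : ℕ} (Fs : Fin k → Polynomial ℂ) : ℂ :=
  Matrix.det (Matrix.of fun i j : Fin k => (Fs i).coeff (k - 1 - (j : ℕ)))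

/-- The `n`-tuple `p = (μ_1 repeated μ_1 times, …, μ_m repeated μ_m times)`
associated with an `m`-partition `μ` of `n`. -/
def pTuple {m : ℕ} (μ : Fin m → ℕ) (n : ℕ) : Fin n → ℕ := fun i =>
  ((List.ofFn μ).flatMap fun a => List.replicate a a).getD (i : ℕ) 0

/-- `S_p`: the set of all distinct rearrangements of the tuple `p` associated with `μ`. -/
def Sp {m : ℕ} (μ : Fin m → ℕ) (n : ℕ) : Finset (Fin n → ℕ) :=
  Finset.image (fun π : Equiv.Perm (Fin n) => pTuple μ n ∘ π) Finset.univ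

/-- The rows of the `(2n − μ_m) × (2n − μ_m)` determinant for a given rearrangement
`σ ∈ S_p`: the first `n − μ_m` rows are `x^{n−μ_m−1}F, …, xF, F` and the last `n` rows
are `x^{n−1}F^{(σ_1)}/σ_1!, …, xF^{(σ_{n−1})}/σ_{n−1}!, F^{(σ_n)}/σ_n!`. -/
noncomputable def DmuRows (n μm : ℕ) (F : Polynomial ℂ) (σ : Fin n → ℕ) :
    Fin (2 * n - μm) → Polynomial ℂ := fun i =>
  if (i : ℕ) < n - μm then X ^ (n - μm - 1 - (i : ℕ)) * F
  else if h : (i : ℕ) - (n - μm) < n then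
    C (((σ ⟨(i : ℕ) - (n - μm), h⟩).factorial : ℂ))⁻¹ *
      (X ^ (n - 1 - ((i : ℕ) - (n - μm))) * derivative^[σ ⟨(i : ℕ) - (n - μm), h⟩] F)
  else 0

/-- `D_μ(F) = Σ_{σ ∈ S_p} dp[x^{n−μ_m−1}F, …, F, x^{n−1}F^{(σ_1)}/σ_1!, …, F^{(σ_n)}/σ_n!]`,
a determinant of size `2n − μ_m`. -/
noncomputable def Dmu {m : ℕ} (n : ℕ) (μ : Fin m → ℕ) (F : Polynomial ℂ) : ℂ :=
  ∑ σ ∈ Sp μ n,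
    dp (DmuRows n (if h : 0 < m then μ ⟨m - 1, Nat.sub_lt h Nat.one_pos⟩ else 0) F σ)

/-- `mult F = μ`: the multiset of multiplicities of the distinct roots of `F` equals the
multiset of entries of `μ` (equivalently, since `μ_1 ≥ … ≥ μ_m`, the tuple of
multiplicities sorted in decreasing order is `(μ_1, …, μ_m)`). -/
def multEq {m : ℕ} (F : Polynomial ℂ) (μ : Fin m → ℕ) : Prop :=
  (F.roots.toFinset.val.map fun r => rootMultiplicity r F) = Finset.univ.val.map μ

section ShiftMatrix

variable {R : Type*} [CommRing R] {n k : ℕ}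

/-- The matrix whose columns are the coefficients of `x^a G_a` (`a < n`) followed by those of
`x^b f` (`b < k`). -/
noncomputable def shiftMatrix (k : ℕ) (f : R[X]) (G : Fin n → R[X]) :
    Matrix (Fin (n + k)) (Fin (n + k)) R :=
  Matrix.of fun i j => j.addCases (fun a => (X ^ (a : ℕ) * G a).coeff i)
    (fun b => (X ^ (b : ℕ) * f).coeff i)

lemma sylvester_eq_shiftMatrix {f g : R[X]} (hf : f.natDegree ≤ n) (hg : g.natDegree ≤ k) :
    sylvester f g n k = shiftMatrix k f fun _ => g := by
  ext i j
  induction j using Fin.addCases with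
  | left a =>
    simp only [sylvester, shiftMatrix, Matrix.of_apply, Fin.addCases_left, Set.mem_Icc,
      coeff_X_pow_mul']
    split_ifs with h₁ h₂ h₂
    · rfl
    · exact absurd h₁.1 h₂
    · rw [coeff_eq_zero_of_natDegree_lt]
      lia
    · rfl
  | right b =>
    simp only [sylvester, shiftMatrix, Matrix.of_apply, Fin.addCases_right, Set.mem_Icc,
      coeff_X_pow_mul']
    split_ifs with h₁ h₂ h₂
    · rfl
    · exact absurd h₁.1 h₂
    · rw [coeff_eq_zero_of_natDegree_lt]
      lia
    · rfl

lemma det_shiftMatrix_sum {ι : Type*} [DecidableEq ι] (f : R[X]) (S : Finset ι) (t : ι → R)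
    (g : ι → R[X]) :
    (shiftMatrix k f fun _ : Fin n => ∑ v ∈ S, C (t v) * g v).det =
      ∑ τ ∈ Fintype.piFinset fun _ : Fin n => S,
        (∏ a, t (τ a)) * (shiftMatrix k f fun a => g (τ a)).det := by
  simp only [Matrix.det_apply', Finset.mul_sum]
  rw [Finset.sum_comm]
  refine Finset.sum_congr rfl fun π _ => ?_
  simp only [Fin.prod_univ_add, shiftMatrix, Matrix.of_apply, Fin.addCases_left,
    Fin.addCases_right, Finset.mul_sum, finsetSum_coeff, mul_left_comm _ (C _), coeff_C_mul,
    Finset.prod_univ_sum, Finset.sum_mul, Finset.prod_mul_distrib]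
  exact Finset.sum_congr rfl fun τ _ => by ring

lemma shiftMatrix_map {A : Type*} [CommRing A] (φ : R →+* A) (f : R[X]) (G : Fin n → R[X]) :
    shiftMatrix k (f.map φ) (fun a => (G a).map φ) = φ.mapMatrix (shiftMatrix k f G) := by
  ext i j
  induction j using Fin.addCases <;>
    simp [shiftMatrix, coeff_X_pow_mul', apply_ite φ]

end ShiftMatrix

/-- Summed over all rearrangements of a family of polynomials, the determinants of the shift
matrices are given by products of values at the roots. -/
lemma sum_det_shiftMatrix {n k : ℕ} {f : ℂ[X]} (hf : f.natDegree = n) {α : Fin n → ℂ}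
    (hα : f.roots = Finset.univ.val.map α) {S : Finset ℕ} {g : ℕ → ℂ[X]}
    (hg : ∀ v ∈ S, (g v).natDegree ≤ k) (d : ℕ →₀ ℕ) :
    ∑ τ ∈ (Fintype.piFinset fun _ : Fin n => S) with ∑ a, Finsupp.single (τ a) 1 = d,
        (shiftMatrix k f fun a => g (τ a)).det =
      f.leadingCoeff ^ k *
        ∑ τ ∈ (Fintype.piFinset fun _ : Fin n => S) with ∑ a, Finsupp.single (τ a) 1 = d,
          ∏ a, (g (τ a)).eval (α a) := by
  let φ : ℂ →+* MvPolynomial ℕ ℂ := MvPolynomial.C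
  have hφ : Function.Injective φ := MvPolynomial.C_injective _ _
  have hs : f.Splits := IsAlgClosed.splits f
  have hX (τ : Fin n → ℕ) : ∏ a, (MvPolynomial.X (τ a) : MvPolynomial ℕ ℂ) =
      MvPolynomial.monomial (∑ a, Finsupp.single (τ a) 1) 1 := by
    simp [MvPolynomial.X, MvPolynomial.monomial_sum_one]
  have hdeg : (∑ v ∈ S, C (MvPolynomial.X v) * (g v).map φ).natDegree ≤ k :=
    natDegree_sum_le_of_forall_le _ _ fun v hv =>
      (natDegree_C_mul_le _ _).trans (natDegree_map_le.trans (hg v hv))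
  have key := resultant_eq_prod_eval (f.map φ) (∑ v ∈ S, C (MvPolynomial.X v) * (g v).map φ) k
    hdeg (hs.map φ)
  have hmapdeg : (f.map φ).natDegree = n := by rw [natDegree_map_eq_of_injective hφ, hf]
  rw [hmapdeg, resultant, sylvester_eq_shiftMatrix hmapdeg.le hdeg, det_shiftMatrix_sum,
    leadingCoeff_map_of_injective hφ, hs.roots_map_of_injective hφ, hα, Multiset.map_map,
    Multiset.map_map, Finset.prod_map_val] at key
  simp only [Function.comp_apply, eval_finsetSum, eval_mul, eval_C, eval_map_apply,
    Finset.prod_univ_sum, Finset.prod_mul_distrib, shiftMatrix_map, ← RingHom.map_det, hX,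
    ← map_prod, ← map_pow] at key
  have := congr_arg (MvPolynomial.coeff d) key
  simpa only [φ, MvPolynomial.coeff_C_mul, MvPolynomial.coeff_sum, mul_comm _ (MvPolynomial.C _),
    MvPolynomial.coeff_monomial, mul_ite, mul_one, mul_zero, ← Finset.sum_filter] using this

section ReplicateSelf

/-- Replace each element `a` of a multiset of naturals by `a` copies of itself. -/
def replicateSelf (s : Multiset ℕ) : Multiset ℕ := s.bind fun a => Multiset.replicate a a

lemma count_replicateSelf (s : Multiset ℕ) (v : ℕ) :
    (replicateSelf s).count v = v * s.count v := by
  induction s using Multiset.induction_on with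
  | empty => simp [replicateSelf]
  | cons a s ih =>
    simp only [replicateSelf, Multiset.cons_bind, Multiset.count_add, Multiset.count_replicate,
      Multiset.count_cons] at ih ⊢
    rw [ih, mul_add, add_comm]
    by_cases h : v = a
    · simp [h]
    · simp [h, Ne.symm h]

lemma replicateSelf_inj {s t : Multiset ℕ} (hs : 0 ∉ s) (ht : 0 ∉ t) :
    replicateSelf s = replicateSelf t ↔ s = t := by
  refine ⟨fun h => Multiset.ext.2 fun v => ?_, fun h => h ▸ rfl⟩
  rcases Nat.eq_zero_or_pos v with rfl | hv
  · rw [Multiset.count_eq_zero_of_notMem hs, Multiset.count_eq_zero_of_notMem ht]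
  · have := congr_arg (Multiset.count v) h
    rw [count_replicateSelf, count_replicateSelf] at this
    exact Nat.eq_of_mul_eq_mul_left hv this

lemma sum_inv_replicateSelf {s : Multiset ℕ} (hs : 0 ∉ s) :
    ((replicateSelf s).map fun a : ℕ => (a : ℚ)⁻¹).sum = Multiset.card s := by
  induction s using Multiset.induction_on with
  | empty => simp [replicateSelf]
  | cons a s ih =>
    rw [Multiset.mem_cons, not_or] at hs
    have ha : (a : ℚ) ≠ 0 := by exact_mod_cast Ne.symm hs.1
    have := ih hs.2
    simp only [replicateSelf, Multiset.cons_bind, Multiset.map_add, Multiset.sum_add] at this ⊢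
    rw [this]
    simp [ha, add_comm]

lemma map_count_eq_replicateSelf {α : Type*} [DecidableEq α] (s : Multiset α) :
    s.map (fun a => s.count a) = replicateSelf (s.toFinset.val.map fun a => s.count a) := by
  have h : s = s.toFinset.val.bind fun a => Multiset.replicate (s.count a) a := by
    conv_lhs => rw [← Multiset.toFinset_sum_count_nsmul_eq s]
    simp [Finset.sum, Multiset.bind, Multiset.nsmul_singleton, Multiset.join]
  conv_lhs => rw [h]
  rw [Multiset.map_bind, replicateSelf, Multiset.bind_map, ← h]
  simp only [Multiset.map_replicate]

end ReplicateSelf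

section Rearrangement

variable {n : ℕ}

lemma map_univ_eq_iff_sum_single (σ τ : Fin n → ℕ) :
    Finset.univ.val.map σ = Finset.univ.val.map τ ↔
      ∑ a, Finsupp.single (σ a) 1 = ∑ a, Finsupp.single (τ a) 1 := by
  have h (σ : Fin n → ℕ) : Multiset.toFinsupp (Finset.univ.val.map σ) =
      ∑ a, Finsupp.single (σ a) 1 := by
    rw [← Multiset.sum_map_singleton (Finset.univ.val.map σ), map_multiset_sum, Multiset.map_map,
      Multiset.map_map]
    simp [Finset.sum]
  rw [← h, ← h, EmbeddingLike.apply_eq_iff_eq]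

lemma exists_perm_of_map_univ_eq {σ τ : Fin n → ℕ}
    (h : Finset.univ.val.map σ = Finset.univ.val.map τ) : ∃ π : Equiv.Perm (Fin n), τ ∘ π = σ := by
  have e (v : ℕ) : {a // σ a = v} ≃ {a // τ a = v} := by
    refine Fintype.equivOfCardEq ?_
    have := congr_arg (Multiset.count v) h
    simpa only [Multiset.count_map, eq_comm (a := v), ← Finset.filter_val, Finset.card_val,
      ← Fintype.card_subtype] using this
  exact ⟨Equiv.ofFiberEquiv e, funext fun a => Equiv.ofFiberEquiv_map e a⟩

lemma mem_Sp_iff {m : ℕ} {μ : Fin m → ℕ} {σ : Fin n → ℕ} :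
    σ ∈ Sp μ n ↔ Finset.univ.val.map σ = Finset.univ.val.map (pTuple μ n) := by
  simp only [Sp, Finset.mem_image, Finset.mem_univ, true_and]
  refine ⟨?_, exists_perm_of_map_univ_eq⟩
  rintro ⟨π, rfl⟩
  rw [← Multiset.map_map, Multiset.map_univ_val_equiv]

lemma map_pTuple {m : ℕ} {μ : Fin m → ℕ} (hsum : ∑ i, μ i = n) :
    Finset.univ.val.map (pTuple μ n) = replicateSelf (Finset.univ.val.map μ) := by
  have hlen : ((List.ofFn μ).flatMap fun a => List.replicate a a).length = n := by
    simp [List.length_flatMap, List.sum_ofFn, Function.comp_def, hsum]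
  have hlist : List.ofFn (pTuple μ n) = (List.ofFn μ).flatMap fun a => List.replicate a a := by
    refine List.ext_getElem (by simp [hlen]) fun i h₁ h₂ => ?_
    simp [pTuple, List.getElem?_eq_getElem h₂]
  rw [Fin.univ_val_map, Fin.univ_val_map, hlist, replicateSelf, ← Multiset.coe_bind]
  simp only [Multiset.coe_replicate]

end Rearrangement

section Dmu

variable {n : ℕ}

lemma C_inv_factorial_mul_iterate_derivative (F : ℂ[X]) (v : ℕ) :
    C ((v.factorial : ℂ))⁻¹ * derivative^[v] F = hasseDeriv v F := by
  rw [← factorial_smul_hasseDeriv, LinearMap.smul_apply, nsmul_eq_mul, ← C_eq_natCast, ← mul_assoc,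
    ← C_mul, inv_mul_cancel₀ (by exact_mod_cast v.factorial_ne_zero), C_1, one_mul]

lemma dp_DmuRows {μm : ℕ} (h : μm ≤ n) (F : ℂ[X]) (σ : Fin n → ℕ) :
    dp (DmuRows n μm F σ) =
      (shiftMatrix (n - μm) F fun a => hasseDeriv (σ (Fin.rev a)) F).det := by
  let e : Fin (2 * n - μm) ≃ Fin (n + (n - μm)) := Fin.revPerm.trans (finCongr (by lia))
  rw [dp, ← Matrix.det_transpose (shiftMatrix _ _ _), ← Matrix.det_submatrix_equiv_self e]
  congr 1
  ext i j
  have hj : ((e j : Fin _) : ℕ) = 2 * n - μm - 1 - j := by simp [e]; lia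
  simp only [Matrix.of_apply, Matrix.submatrix_apply, Matrix.transpose_apply, shiftMatrix, hj,
    DmuRows]
  by_cases hi : (i : ℕ) < n - μm
  · have he : e i = Fin.natAdd n ⟨n - μm - 1 - i, by lia⟩ := by ext; simp [e]; lia
    rw [if_pos hi, he, Fin.addCases_right]
  · have hi' : (i : ℕ) - (n - μm) < n := by lia
    have he : e i = Fin.castAdd (n - μm) (Fin.rev ⟨i - (n - μm), hi'⟩) := by ext; simp [e]; lia
    rw [if_neg hi, dif_pos hi', he, Fin.addCases_left, mul_left_comm,
      C_inv_factorial_mul_iterate_derivative, Fin.rev_rev, Fin.val_rev,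
      Nat.sub_sub, add_comm 1]

lemma Sp_eq_filter {m : ℕ} (μ : Fin m → ℕ) :
    Sp μ n = {τ ∈ Fintype.piFinset fun _ : Fin n => Finset.univ.image (pTuple μ n) |
      ∑ a, Finsupp.single (τ a) 1 = ∑ a, Finsupp.single (pTuple μ n a) 1} := by
  ext σ
  rw [Finset.mem_filter, mem_Sp_iff, ← map_univ_eq_iff_sum_single, Fintype.mem_piFinset,
    iff_and_self]
  intro h a
  have : σ a ∈ Finset.univ.val.map σ := Multiset.mem_map_of_mem _ (Finset.mem_univ a)
  rw [h] at this
  simpa using this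

lemma mem_Sp_comp_rev {m : ℕ} {μ : Fin m → ℕ} {σ : Fin n → ℕ} :
    σ ∘ Fin.rev ∈ Sp μ n ↔ σ ∈ Sp μ n := by
  rw [mem_Sp_iff, mem_Sp_iff, ← Multiset.map_map]
  exact iff_of_eq (congr_arg (fun s => Multiset.map σ s = _)
    (Multiset.map_univ_val_equiv Fin.revPerm))

/-- `D_μ(F)` as a symmetric function of the roots of `F`. -/
lemma Dmu_eq_sum_prod_eval {m : ℕ} {μ : Fin m → ℕ} (hm : 0 < m) (hmono : Antitone μ)
    (hsum : ∑ i, μ i = n) {F : ℂ[X]} (hdeg : F.natDegree = n) {α : Fin n → ℂ}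
    (hα : F.roots = Finset.univ.val.map α) :
    Dmu n μ F = F.leadingCoeff ^ (n - μ ⟨m - 1, Nat.sub_lt hm Nat.one_pos⟩) *
      ∑ σ ∈ Sp μ n, ∏ a, (hasseDeriv (σ a) F).eval (α a) := by
  have hle : μ ⟨m - 1, Nat.sub_lt hm Nat.one_pos⟩ ≤ n :=
    hsum ▸ Finset.single_le_sum (fun _ _ => Nat.zero_le _) (Finset.mem_univ _)
  have hdegG : ∀ v ∈ Finset.univ.image (pTuple μ n), (hasseDeriv v F).natDegree ≤
      n - μ ⟨m - 1, Nat.sub_lt hm Nat.one_pos⟩ := by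
    intro v hv
    have hv' : v ∈ replicateSelf (Finset.univ.val.map μ) := by
      rw [← map_pTuple hsum]
      simpa using hv
    obtain ⟨i, rfl⟩ : ∃ i, μ i = v := by
      obtain ⟨b, hb, hvb⟩ := Multiset.mem_bind.1 hv'
      obtain ⟨i, -, rfl⟩ := Multiset.mem_map.1 hb
      exact ⟨i, (Multiset.eq_of_mem_replicate hvb).symm⟩
    have : μ ⟨m - 1, Nat.sub_lt hm Nat.one_pos⟩ ≤ μ i := hmono (Fin.mk_le_mk.2 (by lia))
    have := natDegree_hasseDeriv_le F (μ i)
    lia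
  rw [Dmu, dif_pos hm]
  simp only [dp_DmuRows hle]
  rw [Sp_eq_filter, ← sum_det_shiftMatrix hdeg hα hdegG, ← Sp_eq_filter]
  exact Finset.sum_nbij' (· ∘ Fin.rev) (· ∘ Fin.rev) (fun _ h => mem_Sp_comp_rev.2 h)
    (fun _ h => mem_Sp_comp_rev.2 h) (fun _ _ => by ext; simp) (fun _ _ => by ext; simp)
    (fun _ _ => rfl)

lemma eval_hasseDeriv_eq_zero_of_lt {F : ℂ[X]} {r : ℂ} {v : ℕ} (h : v < F.rootMultiplicity r) :
    (hasseDeriv v F).eval r = 0 := by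
  rw [← C_inv_factorial_mul_iterate_derivative, eval_mul,
    (isRoot_iterate_derivative_of_lt_rootMultiplicity h).eq_zero, mul_zero]

lemma eval_hasseDeriv_rootMultiplicity_ne_zero {F : ℂ[X]} (hF : F ≠ 0) (r : ℂ) :
    (hasseDeriv (F.rootMultiplicity r) F).eval r ≠ 0 := by
  rw [← C_inv_factorial_mul_iterate_derivative, eval_mul, eval_C,
    eval_iterate_derivative_rootMultiplicity, nsmul_eq_mul,
    inv_mul_cancel_left₀ (by exact_mod_cast Nat.factorial_ne_zero _)]
  exact eval_divByMonic_pow_rootMultiplicity_ne_zero r hF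

/-- Two families of positive naturals with equal reciprocal sums that are comparable are equal. -/
lemma eq_of_le_of_sum_inv_eq {ι : Type*} [Fintype ι] {q σ : ι → ℕ} (hq : ∀ a, 0 < q a)
    (hle : ∀ a, q a ≤ σ a) (h : ∑ a, (σ a : ℚ)⁻¹ = ∑ a, (q a : ℚ)⁻¹) : σ = q := by
  have hinv : ∀ a ∈ Finset.univ, (σ a : ℚ)⁻¹ ≤ (q a : ℚ)⁻¹ := fun a _ =>
    inv_anti₀ (by exact_mod_cast hq a) (by exact_mod_cast hle a)
  funext a
  have := (Finset.sum_eq_sum_iff_of_le hinv).1 h a (Finset.mem_univ a)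
  exact_mod_cast inv_injective this

end Dmu

/-- **Main result.**  Let `2 ≤ m ≤ n − 2`, let `μ = (μ_1, …, μ_m)` be an `m`-partition
of `n`, and let `F ∈ ℂ[x]` have degree `n` and exactly `m` distinct complex roots.
Then `D_μ(F) ≠ 0` if and only if `mult F = μ`. -/
theorem Dmu_ne_zero_iff_multEq (n m : ℕ) (hm2 : 2 ≤ m) (hmn : m ≤ n - 2)
    (μ : Fin m → ℕ) (hmono : Antitone μ) (hpos : ∀ i, 1 ≤ μ i) (hsum : ∑ i, μ i = n)
    (F : Polynomial ℂ) (hdeg : F.natDegree = n) (hndr : F.roots.toFinset.card = m) :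
    Dmu n μ F ≠ 0 ↔ multEq F μ := by
  have hF : F ≠ 0 := by rintro rfl; simp at hdeg; lia
  have hcard : Multiset.card F.roots = n :=
    (IsAlgClosed.splits F).natDegree_eq_card_roots.symm.trans hdeg
  obtain ⟨α, hα⟩ : ∃ α : Fin n → ℂ, F.roots = Finset.univ.val.map α := by
    subst hcard
    refine ⟨fun i => F.roots.toList.get (i.cast (Multiset.length_toList _).symm), ?_⟩
    rw [Fin.univ_val_map]
    conv_lhs => rw [← Multiset.coe_toList F.roots]
    exact congr_arg _ (List.ext_getElem (by simp) fun i _ _ => by simp)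
  let M : Multiset ℕ := F.roots.toFinset.val.map fun r => rootMultiplicity r F
  let q : Fin n → ℕ := fun a => F.rootMultiplicity (α a)
  have hqpos (a : Fin n) : 0 < q a := by
    have : α a ∈ F.roots := hα ▸ Multiset.mem_map_of_mem _ (Finset.mem_univ a)
    exact (rootMultiplicity_pos hF).2 (isRoot_of_mem_roots this)
  have hqM : Finset.univ.val.map q = replicateSelf M := by
    have := map_count_eq_replicateSelf F.roots
    simp only [count_roots] at this
    rw [← this, hα, Multiset.map_map]
    rfl
  have hM : 0 ∉ M := by
    intro h
    obtain ⟨r, hr, h0⟩ := Multiset.mem_map.1 h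
    have hr' : r ∈ F.roots := by simpa using hr
    exact ((rootMultiplicity_pos hF).2 (isRoot_of_mem_roots hr')).ne' h0
  have hμ : 0 ∉ Finset.univ.val.map μ := by
    intro h
    obtain ⟨i, -, h0⟩ := Multiset.mem_map.1 h
    exact absurd (hpos i) (by lia)
  have hinv (σ : Fin n → ℕ) (s : Multiset ℕ) (hs : 0 ∉ s)
      (h : Finset.univ.val.map σ = replicateSelf s) :
      ∑ a, (σ a : ℚ)⁻¹ = Multiset.card s := by
    rw [← sum_inv_replicateSelf hs, ← h, Multiset.map_map]
    rfl
  have hzero : ∀ σ ∈ Sp μ n, σ ≠ q → ∏ a, (hasseDeriv (σ a) F).eval (α a) = 0 := by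
    intro σ hσ hne
    by_contra hprod
    refine hne (eq_of_le_of_sum_inv_eq hqpos (fun a => ?_) ?_)
    · by_contra! hlt
      exact hprod (Finset.prod_eq_zero (Finset.mem_univ a) (eval_hasseDeriv_eq_zero_of_lt hlt))
    · rw [hinv σ _ hμ ((mem_Sp_iff.1 hσ).trans (map_pTuple hsum)), hinv q M hM hqM]
      simpa [M, Multiset.card_toFinset] using hndr.symm
  have hq : ∏ a, (hasseDeriv (q a) F).eval (α a) ≠ 0 :=
    Finset.prod_ne_zero_iff.2 fun a _ => eval_hasseDeriv_rootMultiplicity_ne_zero hF _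
  have hmem : q ∈ Sp μ n ↔ multEq F μ := by
    rw [mem_Sp_iff, map_pTuple hsum, hqM, replicateSelf_inj hM hμ, multEq]
  rw [← hmem, Dmu_eq_sum_prod_eval (by lia) hmono hsum hdeg hα, mul_ne_zero_iff,
    and_iff_right (pow_ne_zero _ (leadingCoeff_ne_zero.2 hF))]
  constructor
  · intro h
    by_contra hnot
    exact h (Finset.sum_eq_zero fun σ hσ => hzero σ hσ fun h => hnot (h ▸ hσ))
  · intro h
    rwa [Finset.sum_eq_single_of_mem q h hzero]
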